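/- arXiv:1801.10259 — 5 statements merged into one kernel-verified Lean document; each statement's English description precedes it below -/
import Mathlib

section
/- Let u, v be nonzero, non-parallel vectors in E. Then: (i) ω(u∨, v) − ω(v∨, u) = ω(u∨, u+v); and (ii) for any real scalars a, b, c with b ≠ 0 and c ≠ 0, ω((au+bv)∨, cu) = (1/b)·ω(v∨, u). -/
open scoped RealInnerProductSpace

noncomputable section

variable {E : Type*} [NormedAddCommGroup E] [InnerProductSpace ℝ E] [FiniteDimensional ℝ E]

/-- `omg u v` is the vector `ω(u∨, v)` from the paper:
`ω(u∨, v) = ( −2(v|v)·u + 2(u|v)·v ) / ( (u|u)(v|v) − (u|v)² )`. -/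
def omg (u v : E) : E :=
  (⟪u, u⟫ * ⟪v, v⟫ - ⟪u, v⟫ ^ 2)⁻¹ • ((-2 * ⟪v, v⟫) • u + (2 * ⟪u, v⟫) • v)

/-- Lemma on ω: (i) `ω(u∨, v) − ω(v∨, u) = ω(u∨, u+v)`; (ii) for scalars `a, b, c` with
`b ≠ 0`, `c ≠ 0`, `ω((au+bv)∨, cu) = (1/b)·ω(v∨, u)`. -/
theorem omg_identities (u v : E) (h : LinearIndependent ℝ ![u, v]) :
    omg u v - omg v u = omg u (u + v) ∧
    ∀ a b c : ℝ, b ≠ 0 → c ≠ 0 →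
      omg (a • u + b • v) (c • u) = b⁻¹ • omg v u := by
  have sym : ⟪v, u⟫ = ⟪u, v⟫ := real_inner_comm u v
  refine ⟨?_, fun a b c hb hc => ?_⟩
  · have gram : ⟪u, u⟫ * ⟪u + v, u + v⟫ - ⟪u, u + v⟫ ^ 2 =
        ⟪u, u⟫ * ⟪v, v⟫ - ⟪u, v⟫ ^ 2 := by
      simp only [inner_add_left, inner_add_right, sym]
      ring
    simp only [omg, gram]
    rw [sym, mul_comm ⟪v, v⟫ ⟪u, u⟫]
    simp only [inner_add_left, inner_add_right, sym]
    module
  · have gram : ⟪a • u + b • v, a • u + b • v⟫ * ⟪c • u, c • u⟫ - ⟪a • u + b • v, c • u⟫ ^ 2 =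
        b ^ 2 * c ^ 2 * (⟪v, v⟫ * ⟪u, u⟫ - ⟪u, v⟫ ^ 2) := by
      simp only [inner_add_left, inner_add_right, real_inner_smul_left, real_inner_smul_right, sym]
      ring
    simp only [omg, gram, mul_inv]
    rw [sym]
    simp only [inner_add_left, real_inner_smul_left, real_inner_smul_right, sym]
    match_scalars <;> field_simp <;> ring

end
end

section
/- Let u, v be nonzero, non-parallel vectors in E. Then: (i) (u∨|u+v)·(u∨ + ω(u∨, v)) = (u∨|v)·(u∨ + ω(u∨, u+v)); and (ii) −2·(u∨ + ω(u∨, v)) = (u∨|v)·ω(v∨, u). (When (u∨|v) ≠ 0 these say (u∨+ω(u∨,v))/(u∨|v) = (u∨+ω(u∨,u+v))/(u∨|u+v) = ω(v∨,u)/(−2).) -/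
open scoped RealInnerProductSpace

noncomputable section

variable {E : Type*} [NormedAddCommGroup E] [InnerProductSpace ℝ E] [FiniteDimensional ℝ E]

/-- `cv u = u∨ = 2u/(u|u)`. -/
def cv (u : E) : E := (2 / ⟪u, u⟫) • u

theorem gram_ne_zero {u v : E} (h : LinearIndependent ℝ ![u, v]) :
    ⟪u, u⟫ * ⟪v, v⟫ - ⟪u, v⟫ ^ 2 ≠ 0 := by
  intro hD
  have hu : u ≠ 0 := h.ne_zero 0
  have hw : ⟪-⟪u, v⟫ • u + ⟪u, u⟫ • v, -⟪u, v⟫ • u + ⟪u, u⟫ • v⟫ = 0 := by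
    simp only [inner_add_left, inner_add_right, real_inner_smul_left, real_inner_smul_right,
      real_inner_comm u v]
    linear_combination ⟪u, u⟫ * hD
  exact hu (inner_self_eq_zero.mp
    (LinearIndependent.pair_iff.mp h _ _ (inner_self_eq_zero.mp hw)).2)

theorem cv_add_omg {u v : E} (h : LinearIndependent ℝ ![u, v]) :
    cv u + omg u v =
      (2 * ⟪u, v⟫ / (⟪u, u⟫ * ⟪v, v⟫ - ⟪u, v⟫ ^ 2)) • (v - (⟪u, v⟫ / ⟪u, u⟫) • u) := by
  have hD := gram_ne_zero h
  have hu : ⟪u, u⟫ ≠ 0 := inner_self_ne_zero.mpr (h.ne_zero 0)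
  unfold cv omg
  match_scalars <;> field_simp
  ring

/-- (i) `(u∨|u+v)·(u∨ + ω(u∨, v)) = (u∨|v)·(u∨ + ω(u∨, u+v))`;
    (ii) `−2·(u∨ + ω(u∨, v)) = (u∨|v)·ω(v∨, u)`. -/
theorem omg_identities' (u v : E) (h : LinearIndependent ℝ ![u, v]) :
    ⟪cv u, u + v⟫ • (cv u + omg u v) = ⟪cv u, v⟫ • (cv u + omg u (u + v)) ∧
    (-2 : ℝ) • (cv u + omg u v) = ⟪cv u, v⟫ • omg v u := by
  have hu : ⟪u, u⟫ ≠ 0 := inner_self_ne_zero.mpr (h.ne_zero 0)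
  have hD := gram_ne_zero h
  have h' : LinearIndependent ℝ ![u, u + v] := by
    rw [LinearIndependent.pair_iff] at h ⊢
    intro s t hst
    obtain ⟨h₁, rfl⟩ := h (s + t) t (by rw [← hst]; module)
    exact ⟨by simpa using h₁, rfl⟩
  have hgram : ⟪u, u⟫ * ⟪u + v, u + v⟫ - ⟪u, u + v⟫ ^ 2 =
      ⟪u, u⟫ * ⟪v, v⟫ - ⟪u, v⟫ ^ 2 := by
    simp only [inner_add_left, inner_add_right, real_inner_comm u v]
    ring
  have hcv (w : E) : ⟪cv u, w⟫ = 2 / ⟪u, u⟫ * ⟪u, w⟫ := real_inner_smul_left _ _ _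
  constructor
  · rw [cv_add_omg h, cv_add_omg h', hgram, hcv, hcv, inner_add_right]
    match_scalars <;> field_simp
    ring
  · have hD' : ⟪v, v⟫ * ⟪u, u⟫ - ⟪u, v⟫ ^ 2 ≠ 0 := by rwa [mul_comm]
    rw [cv_add_omg h, hcv, omg, real_inner_comm u v, mul_comm ⟪v, v⟫]
    match_scalars <;> field_simp

end
end

section
/- Let β ∈ Φ and let Ψ ⊆ Φ be a rank-2 root subsystem. If u₁, u₂ ∈ S_Ψ^{(β)}, then ω(u₁∨, β) = ω(u₂∨, β) or ω(u₁∨, β) = −ω(u₂∨, β). -/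
open scoped RealInnerProductSpace Classical

noncomputable section

variable {E : Type*} [NormedAddCommGroup E] [InnerProductSpace ℝ E] [FiniteDimensional ℝ E]

/-- A finite, reduced, crystallographic root system `Φ` in the inner product space `E`,
together with a chosen system of positive roots. -/
structure RootSystemData (E : Type*) [NormedAddCommGroup E] [InnerProductSpace ℝ E] where
  Φ : Finset E
  pos : Finset E
  nonzero : ∀ α ∈ Φ, α ≠ 0
  neg_mem : ∀ α ∈ Φ, -α ∈ Φ
  reduced : ∀ α ∈ Φ, ∀ t : ℝ, t • α ∈ Φ → t = 1 ∨ t = -1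
  crystallographic : ∀ α ∈ Φ, ∀ β ∈ Φ, ∃ n : ℤ, 2 * ⟪α, β⟫ = n * ⟪α, α⟫
  reflect_mem : ∀ α ∈ Φ, ∀ β ∈ Φ, β - (2 * ⟪α, β⟫ / ⟪α, α⟫) • α ∈ Φ
  pos_subset : pos ⊆ Φ
  pos_xor : ∀ α ∈ Φ, Xor' (α ∈ pos) (-α ∈ pos)

/-- `Ψ` is a root subsystem of `Φ`: `Ψ ⊆ Φ` and `⟨Ψ⟩_ℤ ∩ Φ = Ψ`. -/
def RootSystemData.IsSubsystem (R : RootSystemData E) (Ψ : Finset E) : Prop :=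
  Ψ ⊆ R.Φ ∧ ∀ γ ∈ R.Φ, γ ∈ Submodule.span ℤ (Ψ : Set E) → γ ∈ Ψ

/-- `Ψ` is a rank-2 root subsystem of `Φ`. -/
def RootSystemData.IsRank2Subsystem (R : RootSystemData E) (Ψ : Finset E) : Prop :=
  R.IsSubsystem Ψ ∧ Module.finrank ℝ (Submodule.span ℝ (Ψ : Set E)) = 2

/-- `S_Ψ^{(β)} = { u ∈ Φ : (ℤβ + ℤu) ∩ Φ = Ψ }`. -/
def RootSystemData.S (R : RootSystemData E) (Ψ : Finset E) (β : E) : Finset E :=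
  R.Φ.filter fun u =>
    (R.Φ.filter fun γ => γ ∈ Submodule.span ℤ ({β, u} : Set E)) = Ψ

/-- Changing the first argument of `omg` by a sign and a multiple of the second
changes its value by that sign. -/
theorem omg_smul_add {F : Type*} [NormedAddCommGroup F] [InnerProductSpace ℝ F]
    {a b : ℝ} (hb : b ^ 2 = 1) (u v : F) : omg (a • v + b • u) v = b • omg u v := by
  have hgram : ⟪a • v + b • u, a • v + b • u⟫ * ⟪v, v⟫ - ⟪a • v + b • u, v⟫ ^ 2
      = ⟪u, u⟫ * ⟪v, v⟫ - ⟪u, v⟫ ^ 2 := by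
    simp only [inner_add_left, inner_add_right, real_inner_smul_left, real_inner_smul_right,
      real_inner_comm u v]
    linear_combination (⟪u, u⟫ * ⟪v, v⟫ - ⟪u, v⟫ ^ 2) * hb
  unfold omg
  rw [hgram, smul_comm b]
  congr 1
  simp only [inner_add_left, real_inner_smul_left]
  module

/-- Every element of `S_Ψ^{(β)}` spans `Ψ` over `ℤ` together with `β`. -/
theorem RootSystemData.mem_span_pair_of_mem_S {F : Type*} [NormedAddCommGroup F]
    [InnerProductSpace ℝ F] {R : RootSystemData F} {Ψ : Finset F} {β u γ : F}
    (hu : u ∈ R.S Ψ β) (hγ : γ ∈ Ψ) : ∃ m n : ℤ, (m : ℝ) • β + (n : ℝ) • u = γ := by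
  obtain ⟨-, rfl⟩ := Finset.mem_filter.mp hu
  obtain ⟨m, n, h⟩ := Submodule.mem_span_pair.mp (Finset.mem_filter.mp hγ).2
  exact ⟨m, n, by simpa only [Int.cast_smul_eq_zsmul] using h⟩

/-- Every element of `S_Ψ^{(β)}` lies in `Ψ`. -/
theorem RootSystemData.S_subset {F : Type*} [NormedAddCommGroup F]
    [InnerProductSpace ℝ F] (R : RootSystemData F) (Ψ : Finset F) (β : F) : R.S Ψ β ⊆ Ψ := by
  intro u hu
  obtain ⟨hmem, rfl⟩ := Finset.mem_filter.mp hu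
  exact Finset.mem_filter.mpr ⟨hmem, Submodule.subset_span (by simp)⟩

/-- If `Ψ` has rank 2, no element of `S_Ψ^{(β)}` is a multiple of `β`. -/
theorem RootSystemData.ne_smul_of_mem_S {F : Type*} [NormedAddCommGroup F]
    [InnerProductSpace ℝ F] {R : RootSystemData F} {Ψ : Finset F} {β u : F}
    (hΨ : R.IsRank2Subsystem Ψ) (hu : u ∈ R.S Ψ β) (t : ℝ) : u ≠ t • β := by
  intro h
  have hle : Submodule.span ℝ (Ψ : Set F) ≤ Submodule.span ℝ {β} := by
    refine Submodule.span_le.mpr fun γ hγ => ?_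
    obtain ⟨m, n, rfl⟩ := R.mem_span_pair_of_mem_S hu hγ
    exact Submodule.mem_span_singleton.mpr ⟨m + n * t, by rw [h]; module⟩
  have hrank := hΨ.2
  have hmono := Submodule.finrank_mono hle
  have hone := finrank_span_le_card (R := ℝ) ({β} : Set F)
  simp only [Set.toFinset_singleton, Finset.card_singleton] at hone
  lia

/-- If `u₁, u₂ ∈ S_Ψ^{(β)}` then `ω(u₁∨, β) = ± ω(u₂∨, β)`. -/
theorem omg_const_on_S (R : RootSystemData E) {β : E} (hβ : β ∈ R.Φ)
    {Ψ : Finset E} (hΨ : R.IsRank2Subsystem Ψ)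
    {u₁ u₂ : E} (h1 : u₁ ∈ R.S Ψ β) (h2 : u₂ ∈ R.S Ψ β) :
    omg u₁ β = omg u₂ β ∨ omg u₁ β = -omg u₂ β := by
  obtain ⟨a, b, hab⟩ := R.mem_span_pair_of_mem_S h2 (R.S_subset Ψ β h1)
  obtain ⟨c, d, hcd⟩ := R.mem_span_pair_of_mem_S h1 (R.S_subset Ψ β h2)
  have hbd : b * d = 1 := by
    by_contra hne
    have hne' : (1 - b * d : ℝ) ≠ 0 := fun h => hne (by exact_mod_cast (sub_eq_zero.mp h).symm)
    refine R.ne_smul_of_mem_S hΨ h1 ((1 - b * d : ℝ)⁻¹ * (a + b * c)) ?_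
    rw [mul_smul, eq_inv_smul_iff₀ hne']
    rw [← hcd] at hab
    linear_combination (norm := module) (-1 : ℝ) • hab
  rcases Int.eq_one_or_neg_one_of_mul_eq_one hbd with rfl | rfl
  · left
    rw [← hab, omg_smul_add (by norm_num)]
    simp
  · right
    rw [← hab, omg_smul_add (by norm_num)]
    simp

end
end

section
/- For all u, v ∈ E: Σ_{γ ∈ Φ⁺} (γ|u)(γ|v) = h∨ · (u|v), where h∨ is the dual Coxeter number of Φ. -/
open scoped RealInnerProductSpace Classical

noncomputable section

variable {E : Type*} [NormedAddCommGroup E] [InnerProductSpace ℝ E] [FiniteDimensional ℝ E]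

section

variable {V : Type*} [NormedAddCommGroup V] [InnerProductSpace ℝ V]

/-- The nonnegative integral combinations of a finite set of vectors. -/
def IsNatComb (Δ : Finset V) (x : V) : Prop :=
  ∃ c : V → ℕ, x = ∑ i ∈ Δ, (c i : ℝ) • i

theorem IsNatComb.add {Δ : Finset V} {x y : V} (hx : IsNatComb Δ x) (hy : IsNatComb Δ y) :
    IsNatComb Δ (x + y) := by
  obtain ⟨c, rfl⟩ := hx
  obtain ⟨d, rfl⟩ := hy
  refine ⟨fun i => c i + d i, ?_⟩
  rw [← Finset.sum_add_distrib]
  exact Finset.sum_congr rfl fun i _ => by push_cast; rw [add_smul]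

theorem IsNatComb.nsmul {Δ : Finset V} {x : V} (hx : IsNatComb Δ x) (n : ℕ) :
    IsNatComb Δ ((n : ℝ) • x) := by
  obtain ⟨c, rfl⟩ := hx
  refine ⟨fun i => n * c i, ?_⟩
  rw [Finset.smul_sum]
  exact Finset.sum_congr rfl fun i _ => by push_cast; rw [mul_smul]

/-- Coefficients with respect to a linearly independent finite set are unique. -/
theorem coeff_eq_of_sum_smul_eq {Δ : Finset V}
    (hind : LinearIndependent ℝ (fun i : Δ => (i : V))) {a b : V → ℝ}
    (hab : ∑ i ∈ Δ, a i • i = ∑ i ∈ Δ, b i • i) {i : V} (hi : i ∈ Δ) : a i = b i := by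
  have key := Fintype.linearIndependent_iff.1 hind (fun i => a i - b i) (by
    rw [Finset.sum_coe_sort Δ (fun i => (a i - b i) • i)]
    simp only [sub_smul, Finset.sum_sub_distrib, hab, sub_self]) ⟨i, hi⟩
  exact sub_eq_zero.1 key

theorem IsNatComb.eq_zero {Δ : Finset V}
    (hind : LinearIndependent ℝ (fun i : Δ => (i : V))) {x : V}
    (hx : IsNatComb Δ x) (hnx : IsNatComb Δ (-x)) : x = 0 := by
  obtain ⟨c, hc⟩ := hx
  obtain ⟨d, hd⟩ := hnx
  have key : ∀ i ∈ Δ, (c i : ℝ) = 0 := by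
    intro i hi
    have := coeff_eq_of_sum_smul_eq hind (a := fun i => (c i : ℝ)) (b := fun i => -(d i : ℝ))
      (by simp only [neg_smul, Finset.sum_neg_distrib, ← hc, ← hd, neg_neg]) hi
    have h1 : (0 : ℝ) ≤ c i := Nat.cast_nonneg _
    have h2 : (0 : ℝ) ≤ d i := Nat.cast_nonneg _
    linarith
  rw [hc]
  exact Finset.sum_eq_zero fun i hi => by rw [key i hi, zero_smul]

/-- The reflection in the hyperplane orthogonal to `α`. -/
def rootReflection (α x : V) : V := x - (2 * ⟪α, x⟫ / ⟪α, α⟫) • α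

theorem inner_rootReflection {α : V} (hα : α ≠ 0) (x : V) :
    ⟪α, rootReflection α x⟫ = -⟪α, x⟫ := by
  have h0 : ⟪α, α⟫ ≠ 0 := inner_self_ne_zero.2 hα
  rw [rootReflection, inner_sub_right, inner_smul_right]
  field_simp
  ring

theorem rootReflection_rootReflection {α : V} (hα : α ≠ 0) (x : V) :
    rootReflection α (rootReflection α x) = x := by
  conv_lhs => rw [rootReflection, inner_rootReflection hα, rootReflection]
  rw [mul_neg, neg_div, neg_smul]
  abel

theorem rootReflection_sum {ι : Type*} (s : Finset ι) (α : V) (f : ι → V) :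
    rootReflection α (∑ i ∈ s, f i) = ∑ i ∈ s, rootReflection α (f i) := by
  simp only [rootReflection, inner_sum, Finset.sum_sub_distrib, Finset.mul_sum, Finset.sum_div,
    Finset.sum_smul]

theorem rootReflection_smul (α : V) (t : ℝ) (x : V) :
    rootReflection α (t • x) = t • rootReflection α x := by
  simp only [rootReflection, inner_smul_right, smul_sub, smul_smul]
  congr 2
  ring

/-- A function of a root that is invariant under `γ ↦ -γ` sums over all roots to twice its sum over
the positive roots. -/
theorem RootSystemData.sum_eq_two_mul_sum_pos (R : RootSystemData V) (f : V → ℝ)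
    (hf : ∀ γ, f (-γ) = f γ) : ∑ γ ∈ R.Φ, f γ = 2 * ∑ γ ∈ R.pos, f γ := by
  have hneg : ∑ γ ∈ R.Φ \ R.pos, f γ = ∑ γ ∈ R.pos, f γ := by
    refine Finset.sum_bij' (fun γ _ => -γ) (fun γ _ => -γ) ?_ ?_ ?_ ?_ ?_
    · intro γ hγ
      rw [Finset.mem_sdiff] at hγ
      rcases R.pos_xor γ hγ.1 with h | h
      · exact absurd h.1 hγ.2
      · exact h.1
    · intro γ hγ
      have hΦ := R.pos_subset hγ
      rw [Finset.mem_sdiff]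
      refine ⟨R.neg_mem γ hΦ, ?_⟩
      rcases R.pos_xor γ hΦ with h | h
      · exact h.2
      · exact absurd hγ h.2
    · intro γ _; exact neg_neg γ
    · intro γ _; exact neg_neg γ
    · intro γ _; exact (hf γ).symm
  rw [← Finset.sum_sdiff R.pos_subset, hneg, two_mul]

/-- The operator `u ↦ ∑ γ ∈ Φ, (γ|u) γ` has every root as an eigenvector. -/
theorem RootSystemData.exists_sum_inner_smul_eq (R : RootSystemData V) {α : V} (hα : α ∈ R.Φ) :
    ∃ t : ℝ, ∑ γ ∈ R.Φ, ⟪γ, α⟫ • γ = t • α := by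
  have hα0 := R.nonzero α hα
  set x := ∑ γ ∈ R.Φ, ⟪γ, α⟫ • γ with hx
  have hrefl : rootReflection α x = -x := by
    rw [hx, rootReflection_sum, ← Finset.sum_neg_distrib]
    refine Finset.sum_bij' (fun γ _ => rootReflection α γ) (fun γ _ => rootReflection α γ)
      (fun γ hγ => R.reflect_mem α hα γ hγ) (fun γ hγ => R.reflect_mem α hα γ hγ)
      (fun γ _ => rootReflection_rootReflection hα0 γ)
      (fun γ _ => rootReflection_rootReflection hα0 γ) ?_
    intro γ _
    rw [rootReflection_smul, real_inner_comm α (rootReflection α γ), inner_rootReflection hα0,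
      real_inner_comm, neg_smul, neg_neg]
  refine ⟨⟪α, x⟫ / ⟪α, α⟫, ?_⟩
  rw [rootReflection, sub_eq_iff_eq_add, ← sub_eq_iff_eq_add'] at hrefl
  have h2 : (2 : ℝ) • x = (2 : ℝ) • ((⟪α, x⟫ / ⟪α, α⟫) • α) := by
    rw [smul_smul, ← mul_div_assoc, ← hrefl, two_smul]
    abel
  exact smul_right_injective V two_ne_zero h2

/-- For an irreducible root system spanning the space, the operator `u ↦ ∑ γ ∈ Φ, (γ|u) γ` is a
scalar. -/
theorem RootSystemData.exists_forall_sum_inner_mul_inner_eq (R : RootSystemData V)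
    (hspan : Submodule.span ℝ (R.Φ : Set V) = ⊤)
    (hirr : ¬ ∃ Φ₁ Φ₂ : Finset V, Φ₁.Nonempty ∧ Φ₂.Nonempty ∧ Φ₁ ∪ Φ₂ = R.Φ ∧
      ∀ a ∈ Φ₁, ∀ b ∈ Φ₂, ⟪a, b⟫ = 0) (hne : R.Φ.Nonempty) :
    ∃ t : ℝ, ∀ u v : V, ∑ γ ∈ R.Φ, ⟪γ, u⟫ * ⟪γ, v⟫ = t * ⟪u, v⟫ := by
  obtain ⟨α, hα⟩ := hne
  obtain ⟨t, ht⟩ := R.exists_sum_inner_smul_eq hα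
  have hinner : ∀ u v : V, ⟪∑ γ ∈ R.Φ, ⟪γ, u⟫ • γ, v⟫ = ∑ γ ∈ R.Φ, ⟪γ, u⟫ * ⟪γ, v⟫ := by
    intro u v
    simp only [sum_inner, real_inner_smul_left]
  have hroot : ∀ β ∈ R.Φ, ∑ γ ∈ R.Φ, ⟪γ, β⟫ • γ = t • β := by
    by_contra! hcon
    obtain ⟨β, hβ, hβt⟩ := hcon
    refine hirr ⟨R.Φ.filter (fun β => ∑ γ ∈ R.Φ, ⟪γ, β⟫ • γ = t • β),
      R.Φ.filter (fun β => ¬ ∑ γ ∈ R.Φ, ⟪γ, β⟫ • γ = t • β),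
      ⟨α, Finset.mem_filter.2 ⟨hα, ht⟩⟩, ⟨β, Finset.mem_filter.2 ⟨hβ, hβt⟩⟩,
      Finset.filter_union_filter_not_eq _ _, ?_⟩
    intro a ha b hb
    rw [Finset.mem_filter] at ha hb
    obtain ⟨s, hs⟩ := R.exists_sum_inner_smul_eq hb.1
    have hst : s ≠ t := by
      rintro rfl
      exact hb.2 hs
    have h1 := hinner a b
    have h2 := hinner b a
    rw [ha.2, real_inner_smul_left] at h1
    rw [hs, real_inner_smul_left, real_inner_comm a b] at h2
    have h3 : ∑ γ ∈ R.Φ, ⟪γ, a⟫ * ⟪γ, b⟫ = ∑ γ ∈ R.Φ, ⟪γ, b⟫ * ⟪γ, a⟫ :=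
      Finset.sum_congr rfl fun _ _ => mul_comm _ _
    have h4 : (s - t) * ⟪a, b⟫ = 0 := by linarith
    exact (mul_eq_zero.1 h4).resolve_left (sub_ne_zero.2 hst)
  refine ⟨t, fun u v => ?_⟩
  have hu : u ∈ Submodule.span ℝ (R.Φ : Set V) := hspan ▸ Submodule.mem_top
  induction hu using Submodule.span_induction with
  | mem x hx => rw [← hinner, hroot x hx, real_inner_smul_left]
  | zero => simp
  | add x y _ _ hx hy =>
    simp only [inner_add_right, add_mul, Finset.sum_add_distrib, hx, hy, inner_add_left]
    ring
  | smul a x _ hx =>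
    simp only [inner_smul_right, mul_assoc, ← Finset.mul_sum, hx, real_inner_smul_left]
    ring

/-- The reflection in a simple root permutes the other positive roots. -/
theorem RootSystemData.rootReflection_mem_pos_erase (R : RootSystemData V) {Δ : Finset V}
    (hΔΦ : Δ ⊆ R.Φ) (hind : LinearIndependent ℝ (fun i : Δ => (i : V)))
    (hpos : ∀ γ, γ ∈ R.pos ↔ γ ∈ R.Φ ∧ IsNatComb Δ γ) {α : V} (hα : α ∈ Δ) {γ : V}
    (hγ : γ ∈ R.pos.erase α) : rootReflection α γ ∈ R.pos.erase α := by
  rw [Finset.mem_erase] at hγ ⊢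
  obtain ⟨hγα, hγp⟩ := hγ
  obtain ⟨hγΦ, c, hc⟩ := (hpos γ).1 hγp
  have hαΦ := hΔΦ hα
  have hmem : rootReflection α γ ∈ R.Φ := R.reflect_mem α hαΦ γ hγΦ
  have hj : ∃ j ∈ Δ, j ≠ α ∧ c j ≠ 0 := by
    by_contra! hcon
    have hcα : γ = (c α : ℝ) • α := by
      rw [hc]
      exact Finset.sum_eq_single_of_mem α hα fun j hj hja => by rw [hcon j hj hja]; simp
    rcases R.reduced α hαΦ (c α) (hcα ▸ hγΦ) with h1 | h1
    · exact hγα (by rw [hcα, h1, one_smul])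
    · have : (0 : ℝ) ≤ c α := Nat.cast_nonneg _
      linarith
  obtain ⟨j, hjΔ, hjα, hcj⟩ := hj
  have hnot : ∀ (t : ℝ) (d : V → ℕ), -(γ - t • α) ≠ ∑ i ∈ Δ, (d i : ℝ) • i := by
    intro t d hd
    have := coeff_eq_of_sum_smul_eq hind (a := fun i => (c i : ℝ) + d i)
      (b := fun i => if i = α then t else 0) (by
        simp only [add_smul, Finset.sum_add_distrib, ← hc, ← hd, ite_smul, zero_smul,
          Finset.sum_ite_eq', hα, if_true]
        abel) hjΔ
    simp only [if_neg hjα] at this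
    have h1 : (0 : ℝ) < c j := Nat.cast_pos.2 (Nat.pos_of_ne_zero hcj)
    have h2 : (0 : ℝ) ≤ d j := Nat.cast_nonneg _
    linarith
  constructor
  · intro hEq
    refine hnot (2 * ⟪α, γ⟫ / ⟪α, α⟫ + 1) 0 ?_
    rw [add_smul, one_smul, ← sub_sub, ← rootReflection, hEq]
    simp
  · rcases R.pos_xor _ hmem with h1 | h1
    · exact h1.1
    · obtain ⟨d, hd⟩ := ((hpos _).1 h1.1).2
      exact absurd hd (hnot _ d)

/-- A simple root `α` satisfies `(2ρ|α) = (α|α)`, where `2ρ` is the sum of the positive roots. -/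
theorem RootSystemData.sum_pos_inner_simple (R : RootSystemData V) {Δ : Finset V}
    (hΔΦ : Δ ⊆ R.Φ) (hind : LinearIndependent ℝ (fun i : Δ => (i : V)))
    (hpos : ∀ γ, γ ∈ R.pos ↔ γ ∈ R.Φ ∧ IsNatComb Δ γ) {α : V} (hα : α ∈ Δ) :
    ∑ γ ∈ R.pos, ⟪γ, α⟫ = ⟪α, α⟫ := by
  have hα0 := R.nonzero α (hΔΦ hα)
  have hαp : α ∈ R.pos := (hpos α).2 ⟨hΔΦ hα, fun i => if i = α then 1 else 0, by simp [hα]⟩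
  have hmem := fun γ (hγ : γ ∈ R.pos.erase α) =>
    R.rootReflection_mem_pos_erase hΔΦ hind hpos hα hγ
  have hswap : ∑ γ ∈ R.pos.erase α, ⟪γ, α⟫ = ∑ γ ∈ R.pos.erase α, -⟪γ, α⟫ := by
    refine Finset.sum_bij' (fun γ _ => rootReflection α γ) (fun γ _ => rootReflection α γ)
      hmem hmem (fun γ _ => rootReflection_rootReflection hα0 γ)
      (fun γ _ => rootReflection_rootReflection hα0 γ) ?_
    intro γ _
    rw [real_inner_comm α (rootReflection α γ), inner_rootReflection hα0, neg_neg,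
      real_inner_comm]
  rw [Finset.sum_neg_distrib] at hswap
  rw [← Finset.add_sum_erase _ _ hαp]
  linarith

/-- A positive root other than the highest root `θ`, normalized by `(θ|θ) = 2`, has inner product
`0` or `1` with `θ`. -/
theorem RootSystemData.inner_highest_eq_zero_or_one (R : RootSystemData V) {Δ : Finset V}
    (hind : LinearIndependent ℝ (fun i : Δ => (i : V)))
    (hpos : ∀ γ, γ ∈ R.pos ↔ γ ∈ R.Φ ∧ IsNatComb Δ γ) {θ : V} (hθ : θ ∈ R.pos)
    (hhighest : ∀ γ ∈ R.Φ, IsNatComb Δ (θ - γ)) (hnorm : ⟪θ, θ⟫ = 2) {γ : V}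
    (hγ : γ ∈ R.pos) (hγθ : γ ≠ θ) : ⟪γ, θ⟫ = 0 ∨ ⟪γ, θ⟫ = 1 := by
  obtain ⟨hγΦ, hγc⟩ := (hpos γ).1 hγ
  obtain ⟨hθΦ, hθc⟩ := (hpos θ).1 hθ
  obtain ⟨n, hn⟩ := R.crystallographic θ hθΦ γ hγΦ
  have hn' : ⟪θ, γ⟫ = n := by rw [hnorm] at hn; linarith
  have href : γ - (n : ℝ) • θ ∈ R.Φ := by
    have := R.reflect_mem θ hθΦ γ hγΦ
    rwa [hnorm, mul_div_cancel_left₀ _ two_ne_zero, hn'] at this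
  have hlow : 0 ≤ n := by
    by_contra! hlt
    obtain ⟨m, hm⟩ := Int.eq_ofNat_of_zero_le (show 0 ≤ -n - 1 by omega)
    have hnm : (n : ℝ) = -(m : ℝ) - 1 := by
      have : n = -(m : ℤ) - 1 := by omega
      rw [this]; push_cast; ring
    refine R.nonzero γ hγΦ (IsNatComb.eq_zero hind hγc ?_)
    have key := (hhighest _ href).add (hθc.nsmul m)
    convert key using 1
    rw [hnm]
    module
  have hup : n < 2 := by
    by_contra! hge
    obtain ⟨m, hm⟩ := Int.eq_ofNat_of_zero_le (show 0 ≤ n - 2 by omega)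
    have hnm : (n : ℝ) = (m : ℝ) + 2 := by
      have : n = (m : ℤ) + 2 := by omega
      rw [this]; push_cast; ring
    refine hγθ (sub_eq_zero.1 (IsNatComb.eq_zero hind ?_ ?_))
    · have key := (hhighest _ (R.neg_mem _ href)).add (hθc.nsmul m)
      convert key using 1
      rw [hnm]
      module
    · rw [neg_sub]
      exact hhighest γ hγΦ
  rw [real_inner_comm, hn']
  have : n = 0 ∨ n = 1 := by omega
  rcases this with rfl | rfl <;> simp

end

/-- For an irreducible root system `Φ` spanning `E`, with base `Δ` of simple roots, positive
roots the roots which are nonnegative integral combinations of `Δ`, highest root `α̃`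
normalized by `(α̃|α̃) = 2`, and `α̃∨ = Σᵢ gᵢ αᵢ∨` with dual Coxeter number `h∨ = 1 + Σᵢ gᵢ`:
`Σ_{γ ∈ Φ⁺} (γ|u)(γ|v) = h∨ · (u|v)` for all `u, v ∈ E`. -/
theorem sum_pos_inner_eq_dual_coxeter (R : RootSystemData E)
    (hspan : Submodule.span ℝ (R.Φ : Set E) = ⊤)
    (hirr : ¬ ∃ Φ₁ Φ₂ : Finset E, Φ₁.Nonempty ∧ Φ₂.Nonempty ∧ Φ₁ ∪ Φ₂ = R.Φ ∧
      ∀ a ∈ Φ₁, ∀ b ∈ Φ₂, ⟪a, b⟫ = 0)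
    (Δ : Finset E) (hΔΦ : Δ ⊆ R.Φ)
    (hΔind : LinearIndependent ℝ (fun i : Δ => (i : E)))
    (hΔspan : Submodule.span ℝ (Δ : Set E) = ⊤)
    (hpos : ∀ γ, γ ∈ R.pos ↔ γ ∈ R.Φ ∧ ∃ c : E → ℕ, γ = ∑ i ∈ Δ, (c i : ℝ) • i)
    (αt : E) (hαt : αt ∈ R.pos)
    (hhighest : ∀ γ ∈ R.Φ, ∃ c : E → ℕ, αt - γ = ∑ i ∈ Δ, (c i : ℝ) • i)
    (hnorm : ⟪αt, αt⟫ = 2)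
    (g : E → ℤ) (hg : cv αt = ∑ i ∈ Δ, (g i : ℝ) • cv i)
    (h : ℝ) (hh : h = 1 + ∑ i ∈ Δ, (g i : ℝ)) :
    ∀ u v : E, ∑ γ ∈ R.pos, ⟪γ, u⟫ * ⟪γ, v⟫ = h * ⟪u, v⟫ := by
  have hαtΦ := R.pos_subset hαt
  obtain ⟨t, ht⟩ := R.exists_forall_sum_inner_mul_inner_eq hspan hirr ⟨αt, hαtΦ⟩
  have ht' : ∀ u v : E, 2 * ∑ γ ∈ R.pos, ⟪γ, u⟫ * ⟪γ, v⟫ = t * ⟪u, v⟫ := by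
    intro u v
    rw [← ht, R.sum_eq_two_mul_sum_pos (fun γ => ⟪γ, u⟫ * ⟪γ, v⟫)]
    intro γ
    simp only [inner_neg_left, neg_mul_neg]
  have hsq : ∑ γ ∈ R.pos, ⟪γ, αt⟫ * ⟪γ, αt⟫ = 2 + ∑ γ ∈ R.pos, ⟪γ, αt⟫ := by
    rw [← Finset.add_sum_erase _ _ hαt, ← Finset.add_sum_erase _ (fun γ => ⟪γ, αt⟫) hαt, hnorm,
      Finset.sum_congr rfl (g := fun γ => ⟪γ, αt⟫)]
    · ring
    · intro γ hγ
      rw [Finset.mem_erase] at hγ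
      rcases R.inner_highest_eq_zero_or_one hΔind hpos hαt hhighest hnorm hγ.2 hγ.1 with h1 | h1 <;>
        simp [h1]
  have hcv : cv αt = αt := by
    rw [cv, hnorm, div_self two_ne_zero, one_smul]
  have hrho : ∑ γ ∈ R.pos, ⟪γ, αt⟫ = 2 * ∑ i ∈ Δ, (g i : ℝ) := by
    rw [← sum_inner, ← hcv, hg, inner_sum, Finset.mul_sum]
    refine Finset.sum_congr rfl fun i hi => ?_
    have h0 : ⟪i, i⟫ ≠ 0 := inner_self_ne_zero.2 (R.nonzero i (hΔΦ hi))
    rw [cv, inner_smul_right, inner_smul_right, sum_inner,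
      R.sum_pos_inner_simple hΔΦ hΔind hpos hi, div_mul_cancel₀ _ h0, mul_comm]
  have hval := ht' αt αt
  rw [hsq, hrho, hnorm] at hval
  have hth : t = 2 * h := by rw [hh]; linarith
  intro u v
  have huv := ht' u v
  rw [hth] at huv
  linarith

end
end

section
/- For every τ ∈ ℍ, every integer m, and all z, x ∈ ℂ with z ∉ Λ_τ and x ∉ Λ_τ: k(z + m, x|τ) = k(z, x|τ), and k(z + τm, x|τ) = e^{−2πimx} k(z, x|τ) + (e^{−2πimx} − 1)/x. -/
noncomputable section

open Complex

/-- The normalized theta function, given by the product formula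
`θ(z|τ) = (1/(2πi)) e^{πiz} ∏_{s≥1}(1 − qˢe^{2πiz}) ∏_{s≥0}(1 − qˢe^{−2πiz}) ∏_{s≥1}(1 − qˢ)^{−2}`,
where `q = e^{2πiτ}`. -/
def theta (z τ : ℂ) : ℂ :=
  (2 * (Real.pi : ℂ) * I)⁻¹ * exp ((Real.pi : ℂ) * I * z) *
    (∏' s : ℕ, (1 - exp (2 * (Real.pi : ℂ) * I * τ) ^ (s + 1) *
      exp (2 * (Real.pi : ℂ) * I * z))) *
    (∏' s : ℕ, (1 - exp (2 * (Real.pi : ℂ) * I * τ) ^ s *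
      exp (-(2 * (Real.pi : ℂ) * I * z)))) *
    ((∏' s : ℕ, (1 - exp (2 * (Real.pi : ℂ) * I * τ) ^ (s + 1)))⁻¹) ^ 2

/-- `k(z, x|τ) = θ(z+x|τ)/(θ(z|τ)θ(x|τ)) − 1/x`. -/
def kfun (z x τ : ℂ) : ℂ := theta (z + x) τ / (theta z τ * theta x τ) - 1 / x

/-- `w ∈ Λ_τ = ℤ + τℤ`. -/
def InLambda (w τ : ℂ) : Prop := ∃ m n : ℤ, w = (m : ℂ) + (n : ℂ) * τ

/-- Euler-type products `∏ (1 - qˢ a)` split off their first factor when `|q| < 1`. -/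
theorem tprod_one_sub_pow_mul {q : ℂ} (hq : ‖q‖ < 1) (a : ℂ) :
    ∏' s : ℕ, (1 - q ^ s * a) = (1 - a) * ∏' s : ℕ, (1 - q ^ (s + 1) * a) := by
  have h : Multipliable fun s : ℕ => 1 - q ^ (s + 1) * a := by
    have hs : Summable fun s : ℕ => ‖-(q ^ (s + 1) * a)‖ := by
      have := ((summable_nat_add_iff 1).mpr
        (summable_geometric_of_lt_one (norm_nonneg q) hq)).mul_right ‖a‖
      simpa [norm_mul, norm_pow] using this
    simpa [sub_eq_add_neg] using multipliable_one_add_of_summable hs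
  simpa using tprod_eq_zero_mul' (f := fun s : ℕ => 1 - q ^ s * a) h

theorem norm_exp_two_pi_I_mul_lt_one {τ : ℂ} (hτ : 0 < τ.im) :
    ‖exp (2 * (Real.pi : ℂ) * I * τ)‖ < 1 := by
  rw [norm_exp, Real.exp_lt_one_iff]
  simpa using mul_pos Real.two_pi_pos hτ

theorem theta_add_one (z τ : ℂ) : theta (z + 1) τ = -theta z τ := by
  have h₁ : exp ((Real.pi : ℂ) * I * (z + 1)) = -exp ((Real.pi : ℂ) * I * z) := by
    rw [mul_add, mul_one, exp_add, exp_pi_mul_I, mul_neg_one]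
  have h₂ : exp (2 * (Real.pi : ℂ) * I * (z + 1)) = exp (2 * (Real.pi : ℂ) * I * z) := by
    rw [mul_add, mul_one, exp_add, exp_two_pi_mul_I, mul_one]
  simp only [theta, exp_neg, h₁, h₂]
  ring

theorem theta_add_self {τ : ℂ} (hτ : 0 < τ.im) (z : ℂ) :
    theta (z + τ) τ =
      -exp (-((Real.pi : ℂ) * I * τ)) * exp (-(2 * (Real.pi : ℂ) * I * z)) * theta z τ := by
  have hq := norm_exp_two_pi_I_mul_lt_one hτ
  have hQ : exp (2 * (Real.pi : ℂ) * I * τ) = exp ((Real.pi : ℂ) * I * τ) ^ 2 := by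
    rw [← exp_nat_mul]
    congr 1
    push_cast
    ring
  have hp := exp_ne_zero ((Real.pi : ℂ) * I * τ)
  have hu := exp_ne_zero (2 * (Real.pi : ℂ) * I * z)
  have h₁ := tprod_one_sub_pow_mul hq
    (exp (2 * (Real.pi : ℂ) * I * τ) * exp (2 * (Real.pi : ℂ) * I * z))
  have h₂ := tprod_one_sub_pow_mul hq
    ((exp (2 * (Real.pi : ℂ) * I * τ) * exp (2 * (Real.pi : ℂ) * I * z))⁻¹)
  have h₃ (s : ℕ) : exp (2 * (Real.pi : ℂ) * I * τ) ^ (s + 1) *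
      (exp (2 * (Real.pi : ℂ) * I * τ) * exp (2 * (Real.pi : ℂ) * I * z))⁻¹ =
      exp (2 * (Real.pi : ℂ) * I * τ) ^ s * (exp (2 * (Real.pi : ℂ) * I * z))⁻¹ := by
    have := exp_ne_zero (2 * (Real.pi : ℂ) * I * τ)
    field_simp
    ring
  have h₄ (s : ℕ) : exp (2 * (Real.pi : ℂ) * I * τ) ^ s *
      (exp (2 * (Real.pi : ℂ) * I * τ) * exp (2 * (Real.pi : ℂ) * I * z)) =
      exp (2 * (Real.pi : ℂ) * I * τ) ^ (s + 1) * exp (2 * (Real.pi : ℂ) * I * z) := by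
    ring
  simp only [h₃] at h₂
  simp only [h₄] at h₁
  have h₅ : exp (2 * (Real.pi : ℂ) * I * (z + τ)) =
      exp (2 * (Real.pi : ℂ) * I * τ) * exp (2 * (Real.pi : ℂ) * I * z) := by
    rw [mul_add, exp_add, mul_comm]
  have h₆ : exp ((Real.pi : ℂ) * I * (z + τ)) =
      exp ((Real.pi : ℂ) * I * z) * exp ((Real.pi : ℂ) * I * τ) := by
    rw [mul_add, exp_add]
  simp only [theta, exp_neg, h₅, h₆]
  rw [h₁, h₂, hQ]
  field_simp
  ring_nf

/-- A multiplicative quasi-period propagates to all of its integer multiples. -/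
theorem apply_add_mul_intCast_of_exp {F : ℂ → ℂ} {ω c : ℂ}
    (hF : ∀ z, F (z + ω) = exp c * F z) (z : ℂ) (m : ℤ) :
    F (z + ω * m) = exp (m * c) * F z := by
  induction m with
  | zero => simp
  | succ n ih =>
    have h := hF (z + ω * (n : ℤ))
    rw [ih, ← mul_assoc, ← exp_add] at h
    convert h using 2 <;> push_cast <;> ring_nf
  | pred n ih =>
    have h := hF (z + ω * ((-n - 1 : ℤ) : ℂ))
    have e : z + ω * ((-n - 1 : ℤ) : ℂ) + ω = z + ω * ((-n : ℤ) : ℂ) := by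
      push_cast
      ring
    rw [e, ih] at h
    refine mul_left_cancel₀ (exp_ne_zero c) ?_
    rw [← h, ← mul_assoc, ← exp_add]
    congr 2
    push_cast
    ring

theorem theta_add_div_theta_add_one (z x τ : ℂ) :
    theta (z + 1 + x) τ / theta (z + 1) τ = theta (z + x) τ / theta z τ := by
  rw [add_right_comm, theta_add_one, theta_add_one, neg_div_neg_eq]

theorem theta_add_div_theta_add_self {τ : ℂ} (hτ : 0 < τ.im) (z x : ℂ) :
    theta (z + τ + x) τ / theta (z + τ) τ =
      exp (-(2 * (Real.pi : ℂ) * I * x)) * (theta (z + x) τ / theta z τ) := by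
  have h : exp (-(2 * (Real.pi : ℂ) * I * (z + x))) =
      exp (-(2 * (Real.pi : ℂ) * I * z)) * exp (-(2 * (Real.pi : ℂ) * I * x)) := by
    rw [← exp_add]
    ring_nf
  have h₁ := exp_ne_zero (-((Real.pi : ℂ) * I * τ))
  have h₂ := exp_ne_zero (-(2 * (Real.pi : ℂ) * I * z))
  rw [add_right_comm, theta_add_self hτ, theta_add_self hτ, h,
    show ∀ a b c d : ℂ, -a * (b * c) * d = (-a * b) * (c * d) by intros; ring,
    mul_div_mul_left _ _ (mul_ne_zero (neg_ne_zero.mpr h₁) h₂), mul_div_assoc]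

/-- Quasi-periodicity of `k`: for `z, x ∉ Λ_τ` and `m ∈ ℤ`,
`k(z + m, x|τ) = k(z, x|τ)` and
`k(z + τm, x|τ) = e^{−2πimx} k(z, x|τ) + (e^{−2πimx} − 1)/x`. -/
theorem kfun_quasi_periodic (τ : ℂ) (hτ : 0 < τ.im) (m : ℤ) (z x : ℂ)
    (hz : ¬ InLambda z τ) (hx : ¬ InLambda x τ) :
    kfun (z + (m : ℂ)) x τ = kfun z x τ ∧
    kfun (z + τ * (m : ℂ)) x τ =
      exp (-(2 * (Real.pi : ℂ) * I * (m : ℂ) * x)) * kfun z x τ +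
        (exp (-(2 * (Real.pi : ℂ) * I * (m : ℂ) * x)) - 1) / x := by
  have h₁ := apply_add_mul_intCast_of_exp (F := fun w => theta (w + x) τ / theta w τ)
    (ω := 1) (c := 0) (fun w => by simpa using theta_add_div_theta_add_one w x τ) z m
  have h₂ := apply_add_mul_intCast_of_exp (F := fun w => theta (w + x) τ / theta w τ)
    (fun w => theta_add_div_theta_add_self hτ w x) z m
  simp only [one_mul, mul_zero, exp_zero] at h₁
  have e : (m : ℂ) * -(2 * (Real.pi : ℂ) * I * x) = -(2 * (Real.pi : ℂ) * I * (m : ℂ) * x) := by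
    ring
  rw [e] at h₂
  simp only [kfun, ← div_div, h₁, h₂, true_and]
  ring

end
end
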